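/- Let 𝒜 be a MAD family on a set X of cardinality ℵ₁, and let {𝒜₁, 𝒜₂} be a partition of 𝒜 such that 𝒜₁ is nowhere MAD on X and |𝒜₁| ≥ ℵ₁. Suppose that to every A ∈ 𝒜₁ is associated a subset M(A) ⊆ A of cardinality ℵ₁. Then there exists Ã ∈ 𝒜₂ such that Ã ∩ (⋃_{A ∈ 𝒜₁} M(A)) ≠ ∅. -/

import Mathlib

open Cardinal Set TopologicalSpace

/-- A P-space: the intersection of every countable family of open sets is open. -/
def IsPSpace (X : Type*) [TopologicalSpace X] : Prop :=
  ∀ S : Set (Set X), S.Countable → (∀ s ∈ S, IsOpen s) → IsOpen (⋂₀ S)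

/-- Whyburn: for every non-closed `A` and every `x ∈ closure A \ A` there is an
almost closed `F ⊆ A` converging to `x`. -/
def IsWhyburn (X : Type*) [TopologicalSpace X] : Prop :=
  ∀ A : Set X, ¬ IsClosed A → ∀ x ∈ closure A \ A, ∃ F ⊆ A, closure F \ F = {x}

/-- Weakly Whyburn: for every non-closed `A` there are `x ∈ closure A \ A` and an
almost closed `F ⊆ A` converging to `x`. -/
def IsWeaklyWhyburn (X : Type*) [TopologicalSpace X] : Prop :=
  ∀ A : Set X, ¬ IsClosed A → ∃ x ∈ closure A \ A, ∃ F ⊆ A, closure F \ F = {x}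

/-- `ADOn X 𝒜`: `𝒜` is an almost disjoint family on the set `X`: a family of subsets
of `X` of cardinality ℵ₁, any two distinct members of which have intersection of
cardinality less than ℵ₁. -/
def ADOn {S : Type*} (X : Set S) (𝒜 : Set (Set S)) : Prop :=
  (∀ A ∈ 𝒜, A ⊆ X ∧ Cardinal.mk A = Cardinal.aleph 1) ∧
  (∀ A ∈ 𝒜, ∀ B ∈ 𝒜, A ≠ B → Cardinal.mk (↥(A ∩ B)) < Cardinal.aleph 1)

/-- `MADOn X 𝒜`: `𝒜` is a maximal almost disjoint family on the set `X`. -/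
def MADOn {S : Type*} (X : Set S) (𝒜 : Set (Set S)) : Prop :=
  ADOn X 𝒜 ∧ ∀ ℬ : Set (Set S), ADOn X ℬ → 𝒜 ⊆ ℬ → ℬ = 𝒜

/-- The trace of the family `𝒜` on a set `X`: `{X ∩ p : p ∈ 𝒜, X ∩ p uncountable}`. -/
def traceFam {S : Type*} (𝒜 : Set (Set S)) (X : Set S) : Set (Set S) :=
  {Y | ∃ p ∈ 𝒜, ¬ (X ∩ p).Countable ∧ Y = X ∩ p}

/-- `X ∈ I(𝒜)`: there is a countable subfamily `ℱ ⊆ 𝒜` with `X \ ⋃ℱ` countable. -/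
def InIdeal {S : Type*} (𝒜 : Set (Set S)) (X : Set S) : Prop :=
  ∃ ℱ ⊆ 𝒜, ℱ.Countable ∧ (X \ ⋃₀ ℱ).Countable

/-- `𝒜` is nowhere MAD on `X`: every uncountable `Y ⊆ X` on which the trace of `𝒜`
is a MAD family belongs to `I(𝒜)`. -/
def NowhereMADOn {S : Type*} (X : Set S) (𝒜 : Set (Set S)) : Prop :=
  ∀ Y ⊆ X, ¬ Y.Countable → MADOn Y (traceFam 𝒜 Y) → InIdeal 𝒜 Y


theorem countable_iff_mk_lt_aleph_one {S : Type*} (Z : Set S) :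
    Z.Countable ↔ Cardinal.mk Z < Cardinal.aleph 1 := by
  rw [Cardinal.lt_aleph_one_iff, Cardinal.le_aleph0_iff_set_countable]

theorem mk_eq_aleph_one_of_not_countable {S : Type*} (hS : Cardinal.mk S = Cardinal.aleph 1)
    {Z : Set S} (hZ : ¬ Z.Countable) : Cardinal.mk Z = Cardinal.aleph 1 := by
  refine le_antisymm (hS ▸ Cardinal.mk_set_le Z) ?_
  rwa [countable_iff_mk_lt_aleph_one, not_lt] at hZ

theorem not_countable_of_mk_eq_aleph_one {S : Type*} {Z : Set S}
    (hZ : Cardinal.mk Z = Cardinal.aleph 1) : ¬ Z.Countable := by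
  rw [countable_iff_mk_lt_aleph_one, hZ]
  exact lt_irrefl _

/-- Every subset of cardinality ℵ₁ has uncountable intersection with some member of a MAD
family. -/
theorem MADOn.exists_not_countable_inter {S : Type*} {X : Set S} {𝒜 : Set (Set S)}
    (h : MADOn X 𝒜) {Z : Set S} (hZX : Z ⊆ X) (hZ : Cardinal.mk Z = Cardinal.aleph 1) :
    ∃ p ∈ 𝒜, ¬ (Z ∩ p).Countable := by
  by_contra! hcon
  have hAD : ADOn X (insert Z 𝒜) := by
    refine ⟨?_, ?_⟩
    · rintro A (rfl | hA)
      exacts [⟨hZX, hZ⟩, h.1.1 A hA]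
    · rintro A (rfl | hA) B (rfl | hB) hne
      · exact absurd rfl hne
      · exact (countable_iff_mk_lt_aleph_one _).1 (hcon B hB)
      · rw [Set.inter_comm]
        exact (countable_iff_mk_lt_aleph_one _).1 (hcon A hA)
      · exact h.1.2 A hA B hB hne
  have hZ𝒜 : Z ∈ 𝒜 := h.2 _ hAD (Set.subset_insert Z 𝒜) ▸ Set.mem_insert Z 𝒜
  have hc := hcon Z hZ𝒜
  rw [Set.inter_self] at hc
  exact not_countable_of_mk_eq_aleph_one hZ hc

/-- The trace of an almost disjoint family on `Y` is MAD as soon as every uncountable subset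
of `Y` has uncountable intersection with some member of the family. -/
theorem ADOn.madOn_traceFam {S : Type*} (hS : Cardinal.mk S = Cardinal.aleph 1)
    {X Y : Set S} {𝒜 : Set (Set S)} (h : ADOn X 𝒜)
    (hY : ∀ Z ⊆ Y, ¬ Z.Countable → ∃ p ∈ 𝒜, ¬ (Z ∩ p).Countable) :
    MADOn Y (traceFam 𝒜 Y) := by
  refine ⟨⟨?_, ?_⟩, fun ℬ hℬ hsub => Set.Subset.antisymm (fun Z hZ => ?_) hsub⟩
  · rintro _ ⟨p, -, hp, rfl⟩
    exact ⟨Set.inter_subset_left, mk_eq_aleph_one_of_not_countable hS hp⟩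
  · rintro _ ⟨p, hp, -, rfl⟩ _ ⟨q, hq, -, rfl⟩ hne
    have hpq : p ≠ q := fun e => hne (e ▸ rfl)
    exact (Cardinal.mk_le_mk_of_subset
      (Set.inter_subset_inter Set.inter_subset_right Set.inter_subset_right)).trans_lt
      (h.2 p hp q hq hpq)
  · obtain ⟨hZY, hZc⟩ := hℬ.1 Z hZ
    obtain ⟨p, hp, hZp⟩ := hY Z hZY (not_countable_of_mk_eq_aleph_one hZc)
    have hmem : Y ∩ p ∈ traceFam 𝒜 Y :=
      ⟨p, hp, fun hc => hZp (hc.mono (Set.inter_subset_inter_left p hZY)), rfl⟩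
    by_cases hne : Z = Y ∩ p
    · exact hne ▸ hmem
    · have hlt := hℬ.2 Z hZ _ (hsub hmem) hne
      rw [← Set.inter_assoc, Set.inter_eq_self_of_subset_left hZY] at hlt
      exact absurd ((countable_iff_mk_lt_aleph_one _).2 hlt) hZp

/-- An uncountable subset of a member of an almost disjoint family is not almost covered by
countably many other members. -/
theorem ADOn.not_countable_diff_sUnion {S : Type*} {X : Set S} {𝒜 ℱ : Set (Set S)}
    (h : ADOn X 𝒜) (hℱ : ℱ ⊆ 𝒜) (hc : ℱ.Countable) {A B : Set S} (hA : A ∈ 𝒜) (hAℱ : A ∉ ℱ)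
    (hBA : B ⊆ A) (hB : ¬ B.Countable) : ¬ (B \ ⋃₀ ℱ).Countable := by
  intro hdiff
  have hcov : (⋃ F ∈ ℱ, A ∩ F).Countable := hc.biUnion fun F hF =>
    (countable_iff_mk_lt_aleph_one _).2
      (h.2 A hA F (hℱ hF) fun e => hAℱ (e ▸ hF))
  refine hB ((hdiff.union hcov).mono fun x hx => ?_)
  by_cases hxF : x ∈ ⋃₀ ℱ
  · obtain ⟨F, hF, hxF⟩ := hxF
    exact Or.inr (Set.mem_biUnion hF ⟨hBA hx, hxF⟩)
  · exact Or.inl ⟨hx, hxF⟩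

/-- Let 𝒜 be a MAD family on a set of cardinality ℵ₁, partitioned into 𝒜₁ ∪ 𝒜₂
with 𝒜₁ nowhere MAD of cardinality at least ℵ₁, and let every A ∈ 𝒜₁ carry a
subset M A ⊆ A of cardinality ℵ₁. Then some member of 𝒜₂ meets the union of the
sets M A. -/
theorem statement16 (S : Type*) (hS : Cardinal.mk S = Cardinal.aleph 1)
    (𝒜 𝒜₁ 𝒜₂ : Set (Set S))
    (hMAD : MADOn Set.univ 𝒜)
    (hunion : 𝒜₁ ∪ 𝒜₂ = 𝒜) (hdisj : 𝒜₁ ∩ 𝒜₂ = ∅)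
    (hnm : NowhereMADOn Set.univ 𝒜₁)
    (hcard : Cardinal.aleph 1 ≤ Cardinal.mk 𝒜₁)
    (M : Set S → Set S)
    (hM : ∀ A ∈ 𝒜₁, M A ⊆ A ∧ Cardinal.mk (M A) = Cardinal.aleph 1) :
    ∃ A0 ∈ 𝒜₂, (A0 ∩ ⋃ A ∈ 𝒜₁, M A).Nonempty := by
  by_contra hcon
  have hsub : 𝒜₁ ⊆ 𝒜 := hunion ▸ Set.subset_union_left
  have hAD : ADOn Set.univ 𝒜₁ :=
    ⟨fun A hA => hMAD.1.1 A (hsub hA), fun A hA B hB => hMAD.1.2 A (hsub hA) B (hsub hB)⟩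
  have hunc : ¬ 𝒜₁.Countable := by
    rwa [countable_iff_mk_lt_aleph_one, not_lt]
  have hMY : ∀ A ∈ 𝒜₁, M A ⊆ ⋃ A ∈ 𝒜₁, M A := fun A hA => Set.subset_biUnion_of_mem hA
  have hMunc : ∀ A ∈ 𝒜₁, ¬ (M A).Countable := fun A hA =>
    not_countable_of_mk_eq_aleph_one (hM A hA).2
  have hYunc : ¬ (⋃ A ∈ 𝒜₁, M A).Countable := by
    obtain ⟨A, hA⟩ : 𝒜₁.Nonempty :=
      Set.nonempty_iff_ne_empty.2 fun e => hunc (e ▸ Set.countable_empty)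
    exact fun hc => hMunc A hA (hc.mono (hMY A hA))
  have hYMAD : MADOn (⋃ A ∈ 𝒜₁, M A) (traceFam 𝒜₁ (⋃ A ∈ 𝒜₁, M A)) := by
    refine hAD.madOn_traceFam hS fun Z hZY hZ => ?_
    obtain ⟨p, hp, hZp⟩ := hMAD.exists_not_countable_inter (Set.subset_univ Z)
      (mk_eq_aleph_one_of_not_countable hS hZ)
    rw [← hunion] at hp
    refine ⟨p, hp.resolve_right fun hp₂ => hcon ⟨p, hp₂, ?_⟩, hZp⟩
    obtain ⟨x, hxZ, hxp⟩ : (Z ∩ p).Nonempty :=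
      Set.nonempty_iff_ne_empty.2 fun e => hZp (e ▸ Set.countable_empty)
    exact ⟨x, hxp, hZY hxZ⟩
  obtain ⟨ℱ, hℱ, hℱc, hdiff⟩ := hnm _ (Set.subset_univ _) hYunc hYMAD
  obtain ⟨A, hA, hAℱ⟩ : ∃ A ∈ 𝒜₁, A ∉ ℱ := by
    by_contra! hall
    exact hunc (hℱc.mono hall)
  exact hAD.not_countable_diff_sUnion hℱ hℱc hA hAℱ (hM A hA).1 (hMunc A hA)
    (hdiff.mono (Set.sdiff_subset_sdiff_left (hMY A hA)))
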